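/- arXiv:1501.01625 — 3 statements merged into one kernel-verified Lean document; each statement's English description precedes it below -/
import Mathlib

section
/- Let n ≥ 3, let ξ ∈ 𝕊^{n-1}, and let T be an orthogonal linear transformation of ℝⁿ mapping ξ to the first standard basis vector e₁ = (1,0,…,0). Then for every ε > 0 and every κ ∈ T*(𝓑_ε) (i.e. every κ ∈ ℝⁿ with Tκ ∈ 𝓑_ε), there exists ζ ∈ 𝕊^{n-1} such that κ · ζ = 0 and |ζ − ξ| < ε. -/
open Real MeasureTheory
open scoped RealInnerProductSpace

/-- The set `𝓑_ε` (depending on `η = η(ε)`) of vectors of `ℝⁿ` given in spherical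
coordinates by `β₁ = s cos θ₁`, `β_j = s cos θ_j ∏_{k=1}^{j-1} sin θ_k` for
`j = 2, …, n-2`, `β_{n-1} = s sin φ ∏_{k=1}^{n-2} sin θ_k`,
`β_n = s cos φ ∏_{k=1}^{n-2} sin θ_k`, where `s ∈ (0,1)`,
`θ₁ ∈ (π/2 - η, π/2 + η)`, `θ₂ ∈ (0, π/3)`, `θ_j ∈ (0, π)` for `j = 3, …, n-2`,
and `φ ∈ (0, 2π)`.  (Indices of coordinates are 0-based in Lean: `β i` is `β_{i+1}`.) -/
def sphericalFrustum (n : ℕ) (η : ℝ) : Set (EuclideanSpace ℝ (Fin n)) :=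
  {β | ∃ (s φ : ℝ) (θ : ℕ → ℝ),
    s ∈ Set.Ioo (0 : ℝ) 1 ∧
    θ 1 ∈ Set.Ioo (π / 2 - η) (π / 2 + η) ∧
    θ 2 ∈ Set.Ioo (0 : ℝ) (π / 3) ∧
    (∀ j, 3 ≤ j → j ≤ n - 2 → θ j ∈ Set.Ioo (0 : ℝ) π) ∧
    φ ∈ Set.Ioo (0 : ℝ) (2 * π) ∧
    (∀ i : Fin n,
      (i.val = 0 → β i = s * Real.cos (θ 1)) ∧
      (1 ≤ i.val → i.val ≤ n - 3 →
        β i = s * Real.cos (θ (i.val + 1)) * ∏ k ∈ Finset.Icc 1 i.val, Real.sin (θ k)) ∧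
      (i.val = n - 2 →
        β i = s * Real.sin φ * ∏ k ∈ Finset.Icc 1 (n - 2), Real.sin (θ k)) ∧
      (i.val = n - 1 →
        β i = s * Real.cos φ * ∏ k ∈ Finset.Icc 1 (n - 2), Real.sin (θ k)))}

/-- The sum of the squares of the first `m` spherical coordinates, together with the square of
the remaining product of sines, equals one. -/
theorem sum_sq_cos_mul_prod_sin (θ : ℕ → ℝ) (m : ℕ) :
    ∑ i : Fin m, (Real.cos (θ (i + 1)) * ∏ k ∈ Finset.Icc 1 (i : ℕ), Real.sin (θ k)) ^ 2 +
      (∏ k ∈ Finset.Icc 1 m, Real.sin (θ k)) ^ 2 = 1 := by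
  induction m with
  | zero => simp
  | succ m ih =>
    rw [Fin.sum_univ_castSucc, Finset.prod_Icc_succ_top (by omega)]
    simp only [Fin.val_castSucc, Fin.val_last]
    linear_combination ih + (∏ k ∈ Finset.Icc 1 m, Real.sin (θ k)) ^ 2 *
      Real.sin_sq_add_cos_sq (θ (m + 1))

/-- A vector at angle `θ` to the unit vector `ξ` is orthogonal to a unit vector whose squared
distance to `ξ` is `2 - 2 sin θ`. -/
theorem exists_unit_orthogonal_of_inner_eq {E : Type*} [NormedAddCommGroup E]
    [InnerProductSpace ℝ E] {ξ κ : E} {θ : ℝ} (hξ : ‖ξ‖ = 1) (hκ : κ ≠ 0)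
    (hinner : ⟪κ, ξ⟫ = ‖κ‖ * Real.cos θ) (hθ : 0 < Real.sin θ) :
    ∃ ζ : E, ‖ζ‖ = 1 ∧ ⟪κ, ζ⟫ = 0 ∧ ‖ζ - ξ‖ ^ 2 = 2 - 2 * Real.sin θ := by
  have hn : ‖κ‖ ≠ 0 := norm_ne_zero_iff.mpr hκ
  have hs : Real.sin θ ≠ 0 := hθ.ne'
  have hsc := Real.sin_sq_add_cos_sq θ
  set ζ : E := (Real.sin θ)⁻¹ • (ξ - (Real.cos θ / ‖κ‖) • κ) with hζ
  have horth : ⟪κ, ζ⟫ = 0 := by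
    rw [hζ, inner_smul_right, inner_sub_right, inner_smul_right, hinner,
      real_inner_self_eq_norm_sq]
    field_simp
    ring
  have hζξ : ⟪ζ, ξ⟫ = Real.sin θ := by
    rw [hζ, real_inner_smul_left, inner_sub_left, real_inner_smul_left, hinner,
      real_inner_self_eq_norm_sq, hξ]
    field_simp
    linear_combination -hsc
  have hζζ : ‖ζ‖ ^ 2 = 1 := by
    have h : ⟪ζ, ζ⟫ = (Real.sin θ)⁻¹ * (⟪ζ, ξ⟫ - Real.cos θ / ‖κ‖ * ⟪κ, ζ⟫) := by
      conv_lhs => rw [hζ, inner_smul_right, inner_sub_right, inner_smul_right, ← hζ]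
      rw [real_inner_comm ζ κ]
    rw [← real_inner_self_eq_norm_sq, h, horth, hζξ]
    field_simp
    ring
  refine ⟨ζ, by nlinarith [norm_nonneg ζ], horth, ?_⟩
  rw [norm_sub_sq_real, hζζ, hζξ, hξ]
  ring

/-- A vector of `sphericalFrustum n η` has first coordinate `‖β‖ cos θ`, with `θ` the first
spherical angle. -/
theorem exists_angle_of_mem_sphericalFrustum {n : ℕ} (hn : 3 ≤ n) {η : ℝ}
    {β : EuclideanSpace ℝ (Fin n)} (hβ : β ∈ sphericalFrustum n η) {i : Fin n} (hi : i.val = 0) :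
    β ≠ 0 ∧ ∃ θ ∈ Set.Ioo (π / 2 - η) (π / 2 + η), β i = ‖β‖ * Real.cos θ := by
  obtain ⟨s, φ, θ, hs, hθ, -, -, -, hc⟩ := hβ
  obtain ⟨m, rfl⟩ : ∃ m, n = m + 2 := ⟨n - 2, by omega⟩
  have hnorm : ‖β‖ ^ 2 = s ^ 2 := by
    rw [EuclideanSpace.real_norm_sq_eq, Fin.sum_univ_castSucc, Fin.sum_univ_castSucc]
    have hinit (i : Fin m) : β i.castSucc.castSucc ^ 2 =
        s ^ 2 * (Real.cos (θ (i + 1)) * ∏ k ∈ Finset.Icc 1 (i : ℕ), Real.sin (θ k)) ^ 2 := by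
      obtain hi | hi := Nat.eq_zero_or_pos (i : ℕ)
      · rw [(hc i.castSucc.castSucc).1 (by simpa using hi)]
        simp [hi, mul_pow]
      · rw [(hc i.castSucc.castSucc).2.1 hi (by simp; omega)]
        simp only [Fin.val_castSucc]
        ring
    rw [(hc (Fin.last m).castSucc).2.2.1 (by simp), (hc (Fin.last (m + 1))).2.2.2 (by simp),
      Finset.sum_congr rfl fun i _ => hinit i, ← Finset.mul_sum, Nat.add_sub_cancel]
    linear_combination s ^ 2 * sum_sq_cos_mul_prod_sin θ m +
      s ^ 2 * (∏ k ∈ Finset.Icc 1 m, Real.sin (θ k)) ^ 2 * Real.sin_sq_add_cos_sq φ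
  have hβs : ‖β‖ = s := (sq_eq_sq₀ (norm_nonneg β) hs.1.le).mp hnorm
  refine ⟨norm_ne_zero_iff.mp (hβs ▸ hs.1.ne'), θ 1, hθ, ?_⟩
  rw [hβs]
  exact (hc i).1 hi

/-- For any orthogonal transformation `T` of `ℝⁿ` mapping `ξ ∈ 𝕊^{n-1}` onto
`e₁`, any `ε > 0` and any `κ ∈ T* 𝓑_ε`, there is `ζ ∈ 𝕊^{n-1}` with `κ · ζ = 0`
and `|ζ - ξ| < ε`. -/
theorem stmt_0 {n : ℕ} (hn : 3 ≤ n)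
    (ξ : EuclideanSpace ℝ (Fin n)) (hξ : ‖ξ‖ = 1)
    (T : EuclideanSpace ℝ (Fin n) ≃ₗᵢ[ℝ] EuclideanSpace ℝ (Fin n))
    (hT : T ξ = EuclideanSpace.single (⟨0, by omega⟩ : Fin n) 1)
    (ε : ℝ) (hε : 0 < ε)
    (η : ℝ) (hη : η ∈ Set.Ioo (0 : ℝ) (π / 2))
    (hηε : ∀ θ ∈ Set.Ioo (π / 2 - η) (π / 2 + η),
      Real.sqrt ((1 - Real.sin θ) ^ 2 + 4 * Real.cos θ ^ 2) < ε)
    (κ : EuclideanSpace ℝ (Fin n)) (hκ : T κ ∈ sphericalFrustum n η) :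
    ∃ ζ : EuclideanSpace ℝ (Fin n), ‖ζ‖ = 1 ∧ ⟪κ, ζ⟫ = 0 ∧ ‖ζ - ξ‖ < ε := by
  obtain ⟨hne, θ, hθ, hcos⟩ := exists_angle_of_mem_sphericalFrustum hn hκ (i := ⟨0, by omega⟩) rfl
  have hsin : 0 < Real.sin θ :=
    Real.sin_pos_of_pos_of_lt_pi (by linarith [hθ.1, hη.2]) (by linarith [hθ.2, hη.2])
  have hinner : ⟪κ, ξ⟫ = ‖κ‖ * Real.cos θ := by
    rw [← T.inner_map_map, hT, EuclideanSpace.inner_single_right, ← T.norm_map κ, ← hcos]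
    simp
  have hκ0 : κ ≠ 0 := fun h => hne (by simp [h])
  obtain ⟨ζ, hζ, horth, hdist⟩ := exists_unit_orthogonal_of_inner_eq hξ hκ0 hinner hsin
  refine ⟨ζ, hζ, horth, (Real.le_sqrt_of_sq_le ?_).trans_lt (hηε θ hθ)⟩
  rw [hdist]
  nlinarith [Real.sin_sq_add_cos_sq θ, sq_nonneg (Real.cos θ)]
end

section
/- Let ε > 0 and let θ₁, θ₂ ∈ ℝ satisfy (1 − sin θ₁)² + 4 cos² θ₁ < ε² and θ₂ ∈ (0, π/3). Define D = (sin² θ₁ + cos² θ₁ / cos² θ₂)^{1/2}, ζ̃₁ = sin θ₁ / D, and ζ̃₂ = −(cos θ₁ / cos θ₂) / D. Then: (i) ζ̃₁² + ζ̃₂² = 1; (ii) cos θ₁ · ζ̃₁ + (sin θ₁ cos θ₂) · ζ̃₂ = 0; and (iii) (ζ̃₁ − 1)² + ζ̃₂² < ε². -/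
open Real

/-- Explicit construction of a unit vector in the plane of the first two coordinates
that is orthogonal to a vector with spherical angles (θ₁, θ₂, …) and ε-close to e₁. -/
theorem stmt_1 (ε θ₁ θ₂ : ℝ) (hε : 0 < ε)
    (h1 : (1 - Real.sin θ₁) ^ 2 + 4 * Real.cos θ₁ ^ 2 < ε ^ 2)
    (h2 : θ₂ ∈ Set.Ioo (0 : ℝ) (π / 3))
    (D ζ₁ ζ₂ : ℝ)
    (hD : D = Real.sqrt (Real.sin θ₁ ^ 2 + Real.cos θ₁ ^ 2 / Real.cos θ₂ ^ 2))
    (hζ₁ : ζ₁ = Real.sin θ₁ / D)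
    (hζ₂ : ζ₂ = -(Real.cos θ₁ / Real.cos θ₂) / D) :
    ζ₁ ^ 2 + ζ₂ ^ 2 = 1 ∧
    Real.cos θ₁ * ζ₁ + (Real.sin θ₁ * Real.cos θ₂) * ζ₂ = 0 ∧
    (ζ₁ - 1) ^ 2 + ζ₂ ^ 2 < ε ^ 2 := by
  obtain ⟨h2pos, h2lt⟩ := h2
  have hc : 1 / 2 < Real.cos θ₂ := by
    rw [← Real.cos_pi_div_three]
    exact Real.cos_lt_cos_of_nonneg_of_le_pi h2pos.le (by linarith [Real.pi_pos]) h2lt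
  have hc0 : 0 < Real.cos θ₂ := by linarith
  have hsc := Real.sin_sq_add_cos_sq θ₁
  have hlow : Real.cos θ₁ ^ 2 ≤ Real.cos θ₁ ^ 2 / Real.cos θ₂ ^ 2 := by
    rw [le_div_iff₀ (by positivity)]
    exact mul_le_of_le_one_right (sq_nonneg _) (Real.cos_sq_le_one θ₂)
  have hup : Real.cos θ₁ ^ 2 / Real.cos θ₂ ^ 2 ≤ 4 * Real.cos θ₁ ^ 2 := by
    rw [div_le_iff₀ (by positivity)]
    nlinarith [mul_nonneg (sq_nonneg (Real.cos θ₁))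
      (by nlinarith : 0 ≤ 4 * Real.cos θ₂ ^ 2 - 1)]
  have hD1 : 1 ≤ D := by
    rw [hD, Real.one_le_sqrt]
    linarith
  have hD0 : 0 < D := by linarith
  have hDsq : D ^ 2 = Real.sin θ₁ ^ 2 + Real.cos θ₁ ^ 2 / Real.cos θ₂ ^ 2 := by
    rw [hD, Real.sq_sqrt (by positivity)]
  have hunit : ζ₁ ^ 2 + ζ₂ ^ 2 = 1 := by
    rw [hζ₁, hζ₂, div_pow, div_pow, neg_sq, div_pow, ← add_div, ← hDsq]
    exact div_self (by positivity)
  refine ⟨hunit, ?_, ?_⟩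
  · rw [hζ₁, hζ₂]
    field_simp
    ring
  · have hs : Real.sin θ₁ = ζ₁ * D := by
      rw [hζ₁]
      field_simp
    have hz : ζ₁ ≤ 1 := by nlinarith [sq_nonneg ζ₂]
    have hprod : 0 ≤ (D - 1) * (D + 1 - 2 * ζ₁) :=
      mul_nonneg (by linarith) (by linarith)
    calc (ζ₁ - 1) ^ 2 + ζ₂ ^ 2 = 2 - 2 * ζ₁ := by linear_combination hunit
      _ ≤ 1 - 2 * (ζ₁ * D) + D ^ 2 := by linarith
      _ = (1 - Real.sin θ₁) ^ 2 + Real.cos θ₁ ^ 2 / Real.cos θ₂ ^ 2 := by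
        rw [hDsq, ← hs]
        ring
      _ < ε ^ 2 := by linarith
end

section
/- Let n ∈ ℕ, t > 0, θ ∈ (0, 1), C' > 0, M > 0, and d ≥ 1. Then there exist constants γ ∈ (0, 1), c > 0 and c̃ > 0, depending only on n, t, θ, C', M and d, with the following property: for every λ ∈ (0, γ), every τ_* > |ln λ| / (2d), and every A ≥ 0 such that A² ≤ C' e^{(n+2) r} |ln λ|^{−θ} + M² / r^{2t} for all r ∈ (0, 2τ_*), one has A ≤ c | ln( c̃ |ln λ| ) |^{−t}. In fact one may take γ ≤ min(e^{−1}, exp(−(M²/((n+2)C'))^{1/(1+2t−θ)})) and c = √2 M ((2t + n + 2) d / θ)^{t}, c̃ = (M²/C')^{1/θ}. -/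
open Real

/-- The choice `r = θ * log (k * L) / (b * d)` balances the two terms of the estimate, because
`C * exp (b * r) * L ^ (-θ) ≤ M ^ 2` at this `r` when `k = (M ^ 2 / C) ^ (1 / θ)`. -/
theorem mul_exp_mul_rpow_le_of_one_lt {θ C M d b L : ℝ} (hθ : 0 < θ) (hC : 0 < C) (hM : 0 < M)
    (hd : 1 ≤ d) (hb : 0 < b) (hL : 0 < L) (hkL : 1 < (M ^ 2 / C) ^ (1 / θ) * L) :
    C * exp (b * (θ * log ((M ^ 2 / C) ^ (1 / θ) * L) / (b * d))) * L ^ (-θ) ≤ M ^ 2 := by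
  have hMC : 0 < M ^ 2 / C := by positivity
  set k := (M ^ 2 / C) ^ (1 / θ) with hk
  have hk0 : 0 < k := rpow_pos_of_pos hMC _
  have hlog : 0 < log (k * L) := log_pos hkL
  have hkθ : k ^ θ = M ^ 2 / C := by
    rw [hk, ← rpow_mul hMC.le, one_div_mul_cancel hθ.ne', rpow_one]
  have hexp : exp (b * (θ * log (k * L) / (b * d))) ≤ (k * L) ^ θ := by
    rw [rpow_def_of_pos (by positivity)]
    refine exp_le_exp.mpr ?_
    have : b * (θ * log (k * L) / (b * d)) = θ * log (k * L) / d := by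
      field_simp
    rw [this, mul_comm (log _)]
    exact div_le_self (by positivity) hd
  calc C * exp (b * (θ * log (k * L) / (b * d))) * L ^ (-θ)
      ≤ C * (k * L) ^ θ * L ^ (-θ) := by gcongr
    _ = M ^ 2 := by
      rw [mul_rpow hk0.le hL.le, hkθ, rpow_neg hL.le]
      have : 0 < L ^ θ := rpow_pos_of_pos hL _
      field_simp

/-- Elementary optimization turning a two-parameter estimate into a log-log bound:
there are `γ ∈ (0,1)`, `c > 0`, `c̃ > 0` (depending only on `n, t, θ, C', M, d`) such
that whenever `λ ∈ (0, γ)`, `τ_* > |ln λ|/(2d)`, and `A ≥ 0` satisfies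
`A² ≤ C' e^{(n+2)r} |ln λ|^{-θ} + M²/r^{2t}` for all `r ∈ (0, 2τ_*)`, one has
`A ≤ c |ln(c̃ |ln λ|)|^{-t}`.  In fact one may take
`γ ≤ min(e^{-1}, exp(-(M²/((n+2)C'))^{1/(1+2t-θ)}))`,
`c = √2 M ((2t+n+2)d/θ)^t` and `c̃ = (M²/C')^{1/θ}`. -/
theorem stmt_14 (n : ℕ) (t θ C' M d : ℝ)
    (ht : 0 < t) (hθ : θ ∈ Set.Ioo (0 : ℝ) 1) (hC' : 0 < C') (hM : 0 < M) (hd : 1 ≤ d) :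
    ∃ γ c ctilde : ℝ,
      γ ∈ Set.Ioo (0 : ℝ) 1 ∧ 0 < c ∧ 0 < ctilde ∧
      γ ≤ min (Real.exp (-1))
          (Real.exp (-(M ^ 2 / ((n + 2) * C')) ^ (1 / (1 + 2 * t - θ)))) ∧
      c = Real.sqrt 2 * M * ((2 * t + n + 2) * d / θ) ^ t ∧
      ctilde = (M ^ 2 / C') ^ (1 / θ) ∧
      ∀ lam : ℝ, lam ∈ Set.Ioo 0 γ →
        ∀ τstar : ℝ, |Real.log lam| / (2 * d) < τstar →
          ∀ A : ℝ, 0 ≤ A →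
            (∀ r : ℝ, r ∈ Set.Ioo 0 (2 * τstar) →
              A ^ 2 ≤ C' * Real.exp ((n + 2) * r) * |Real.log lam| ^ (-θ)
                + M ^ 2 / r ^ (2 * t)) →
            A ≤ c * |Real.log (ctilde * |Real.log lam|)| ^ (-t) := by
  obtain ⟨hθ0, hθ1⟩ := hθ
  have hMC : 0 < M ^ 2 / C' := by positivity
  set X := (M ^ 2 / ((n + 2) * C')) ^ (1 / (1 + 2 * t - θ)) with hX
  have hX0 : 0 ≤ X := by positivity
  set k := (M ^ 2 / C') ^ (1 / θ) with hk
  have hk0 : 0 < k := rpow_pos_of_pos hMC _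
  have hkinv : 0 < k⁻¹ := inv_pos.mpr hk0
  have hn : (0 : ℝ) ≤ n := n.cast_nonneg
  set b : ℝ := 2 * t + n + 2 with hb
  have hb0 : 0 < b := by positivity
  have hd0 : 0 < d := by linarith
  refine ⟨exp (-(1 + X + k⁻¹ + |log k|)), sqrt 2 * M * (b * d / θ) ^ t, k,
    ⟨exp_pos _, exp_lt_one_iff.mpr (by linarith [abs_nonneg (log k)])⟩, by positivity, hk0,
    le_min (exp_le_exp.mpr (by linarith [abs_nonneg (log k)]))
      (exp_le_exp.mpr (by linarith [abs_nonneg (log k)])), rfl, rfl, ?_⟩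
  rintro lam ⟨hlam0, hlam⟩ τ hτ A hA hest
  have hloglam : log lam < -(1 + X + k⁻¹ + |log k|) := by
    rwa [log_lt_iff_lt_exp hlam0]
  have hL : 1 + X + k⁻¹ + |log k| < |log lam| := by
    linarith [neg_le_abs (log lam)]
  set L := |log lam|
  have hL0 : 0 < L := by linarith [abs_nonneg (log k)]
  have hkL : 1 < k * L := by
    have : k⁻¹ < L := by linarith [abs_nonneg (log k)]
    calc 1 = k * k⁻¹ := (mul_inv_cancel₀ hk0.ne').symm
      _ < k * L := by gcongr
  have hlog : 0 < log (k * L) := log_pos hkL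
  have hlogle : log (k * L) < 2 * L := by
    rw [log_mul hk0.ne' hL0.ne']
    linarith [log_le_sub_one_of_pos hL0, le_abs_self (log k)]
  set r := θ * log (k * L) / (b * d) with hr
  have hr0 : 0 < r := by positivity
  have hrτ : r < 2 * τ := by
    have h1 : r < L / d := by
      rw [hr, div_lt_div_iff₀ (by positivity) hd0]
      have : θ * log (k * L) < b * L := by
        nlinarith
      nlinarith
    have h2 : L / d = 2 * (L / (2 * d)) := by
      field_simp
    linarith
  have hpow : r ^ (2 * t) ≤ exp (2 * t * r) := by
    rw [mul_comm (2 * t), exp_mul]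
    exact rpow_le_rpow hr0.le (by linarith [add_one_le_exp r]) (by positivity)
  have hr2t : 0 < r ^ (2 * t) := rpow_pos_of_pos hr0 _
  have hfirst : C' * exp ((n + 2) * r) * L ^ (-θ) ≤ M ^ 2 / r ^ (2 * t) := by
    rw [le_div_iff₀ hr2t]
    calc C' * exp ((n + 2) * r) * L ^ (-θ) * r ^ (2 * t)
        ≤ C' * exp ((n + 2) * r) * L ^ (-θ) * exp (2 * t * r) := by gcongr
      _ = C' * exp (b * r) * L ^ (-θ) := by
        rw [show b * r = (n + 2) * r + 2 * t * r by rw [hb]; ring, exp_add]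
        ring
      _ ≤ M ^ 2 := mul_exp_mul_rpow_le_of_one_lt hθ0 hC' hM hd hb0 hL0 hkL
  have hsq : r ^ (2 * t) = (r ^ t) ^ 2 := by
    rw [← rpow_natCast, ← rpow_mul hr0.le, mul_comm 2 t, Nat.cast_ofNat]
  have hconst : sqrt 2 * M * (b * d / θ) ^ t * |log (k * L)| ^ (-t) = sqrt 2 * M / r ^ t := by
    have hrinv : r = (b * d / θ)⁻¹ * log (k * L) := by
      rw [hr]
      field_simp
    rw [abs_of_pos hlog, hrinv, mul_rpow (by positivity) hlog.le, inv_rpow (by positivity),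
      rpow_neg hlog.le]
    have : 0 < (b * d / θ) ^ t := by positivity
    have : 0 < log (k * L) ^ t := by positivity
    field_simp
  rw [hconst]
  refine (sq_le_sq₀ hA (by positivity)).mp ?_
  calc A ^ 2 ≤ M ^ 2 / r ^ (2 * t) + M ^ 2 / r ^ (2 * t) :=
        (hest r ⟨hr0, hrτ⟩).trans (by gcongr)
    _ = (sqrt 2 * M / r ^ t) ^ 2 := by
      rw [hsq, div_pow, mul_pow, sq_sqrt zero_le_two]
      ring
end
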